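/- Let V_σ(x) = exp(σ^{-1}·min(|x−1|, |x+1|)). There exist constants 0 < α ≤ 1, 0 ≤ M, C < ∞ and σ₀ > 0 such that for all 0 < σ < σ₀ and all x ∈ (−∞, −Mσ): (K̂_σ V_σ)(x) = ∫ V_σ(y) K̂_σ(x, dy) ≤ (1−α)·V_σ(x) + C, where K̂_σ is the restricted Metropolis–Hastings kernel on (−∞,0). -/

import Mathlib

open MeasureTheory Filter Set

/-- Gaussian density `φ_σ` with mean 0 and variance `σ²`. -/
noncomputable def gaussDensity (σ x : ℝ) : ℝ :=
  (Real.sqrt (2 * Real.pi * σ ^ 2))⁻¹ * Real.exp (-(x ^ 2) / (2 * σ ^ 2))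

/-- Density `f_σ` of the mixture `½ N(-1,σ²) + ½ N(1,σ²)`. -/
noncomputable def mixDensity (σ x : ℝ) : ℝ :=
  (1 / 2) * gaussDensity σ (x + 1) + (1 / 2) * gaussDensity σ (x - 1)

/-- The `N(0,σ²)` measure, defined via its density `φ_σ` w.r.t. Lebesgue measure. -/
noncomputable def gaussMeasure (σ : ℝ) : Measure ℝ :=
  volume.withDensity fun z => ENNReal.ofReal (gaussDensity σ z)

/-- The random-walk Metropolis kernel `K_σ(x, ·)` as a measure: the accepted-move part
has density `min(1, f_σ(y)/f_σ(x))` w.r.t. the proposal `x + N(0,σ²)`, and the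
remaining mass `1 − ∫ min(1, f_σ(x+z)/f_σ(x)) φ_σ(z) dz` stays at `x`. -/
noncomputable def rwmKernel (σ : ℝ) (x : ℝ) : Measure ℝ :=
  ((gaussMeasure σ).map (fun z => x + z)).withDensity
      (fun y => ENNReal.ofReal (min 1 (mixDensity σ y / mixDensity σ x)))
  + (ENNReal.ofReal
      (1 - ∫ z, min 1 (mixDensity σ (x + z) / mixDensity σ x) * gaussDensity σ z))
      • Measure.dirac x

/-- The restricted Metropolis–Hastings kernel `K̂_σ` on `(-∞,0)`:
`K̂_σ(x,A) = K_σ(x, A ∩ (-∞,0)) + 1_A(x) K_σ(x,[0,∞))`. -/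
noncomputable def rwmKernelHat (σ : ℝ) (x : ℝ) : Measure ℝ :=
  (rwmKernel σ x).restrict (Set.Iio 0) + (rwmKernel σ x (Set.Ici 0)) • Measure.dirac x

/-- The Lyapunov function `V_σ(x) = exp(σ⁻¹ min(|x-1|,|x+1|))`. -/
noncomputable def lyapV (σ x : ℝ) : ℝ := Real.exp (σ⁻¹ * min |x - 1| |x + 1|)

lemma gaussDensity_nonneg (σ x : ℝ) : 0 ≤ gaussDensity σ x := by
  unfold gaussDensity
  positivity

lemma gaussDensity_pos {σ : ℝ} (hσ : 0 < σ) (x : ℝ) : 0 < gaussDensity σ x := by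
  unfold gaussDensity
  positivity

@[fun_prop]
lemma continuous_gaussDensity (σ : ℝ) : Continuous (gaussDensity σ) := by
  unfold gaussDensity
  fun_prop

lemma gaussDensity_eq_gaussianPDFReal (σ : ℝ) :
    gaussDensity σ = ProbabilityTheory.gaussianPDFReal 0 ⟨σ ^ 2, sq_nonneg σ⟩ := by
  ext x
  simp [gaussDensity, ProbabilityTheory.gaussianPDFReal]
  rfl

lemma integrable_gaussDensity (σ : ℝ) : Integrable (gaussDensity σ) := by
  rw [gaussDensity_eq_gaussianPDFReal]
  exact ProbabilityTheory.integrable_gaussianPDFReal _ _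

lemma integral_gaussDensity {σ : ℝ} (hσ : 0 < σ) : ∫ x, gaussDensity σ x = 1 := by
  rw [gaussDensity_eq_gaussianPDFReal]
  refine ProbabilityTheory.integral_gaussianPDFReal_eq_one _ ?_
  intro h
  exact (pow_pos hσ 2).ne' (congrArg NNReal.toReal h)

lemma gaussDensity_eq_exp_mul (σ x y : ℝ) :
    gaussDensity σ y =
      Real.exp (((|x| / σ) ^ 2 - (|y| / σ) ^ 2) / 2) * gaussDensity σ x := by
  unfold gaussDensity
  rw [mul_left_comm, ← Real.exp_add]
  congr 2
  rw [div_pow, div_pow, sq_abs, sq_abs]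
  ring

lemma gaussDensity_le_gaussDensity {σ x y : ℝ} (h : x ^ 2 ≤ y ^ 2) :
    gaussDensity σ y ≤ gaussDensity σ x := by
  unfold gaussDensity
  gcongr

lemma mixDensity_pos {σ : ℝ} (hσ : 0 < σ) (x : ℝ) : 0 < mixDensity σ x := by
  have h₁ := gaussDensity_pos hσ (x + 1)
  have h₂ := gaussDensity_pos hσ (x - 1)
  unfold mixDensity
  positivity

@[fun_prop]
lemma continuous_mixDensity (σ : ℝ) : Continuous (mixDensity σ) := by
  unfold mixDensity
  fun_prop

lemma mixDensity_le {σ x : ℝ} (hx : x < 0) : mixDensity σ x ≤ gaussDensity σ (x + 1) := by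
  have h : gaussDensity σ (x - 1) ≤ gaussDensity σ (x + 1) :=
    gaussDensity_le_gaussDensity (by nlinarith)
  unfold mixDensity
  linarith

lemma le_mixDensity (σ x : ℝ) : 1 / 2 * gaussDensity σ (x + 1) ≤ mixDensity σ x := by
  have := gaussDensity_nonneg σ (x - 1)
  unfold mixDensity
  linarith

/-- The Metropolis acceptance probability for a move from `x` to `y`. -/
noncomputable def acceptProb (σ x y : ℝ) : ℝ := min 1 (mixDensity σ y / mixDensity σ x)

lemma acceptProb_nonneg {σ : ℝ} (hσ : 0 < σ) (x y : ℝ) : 0 ≤ acceptProb σ x y :=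
  le_min zero_le_one (div_nonneg (mixDensity_pos hσ y).le (mixDensity_pos hσ x).le)

lemma acceptProb_le_one (σ x y : ℝ) : acceptProb σ x y ≤ 1 := min_le_left _ _

@[fun_prop]
lemma continuous_acceptProb (σ x : ℝ) : Continuous (acceptProb σ x) := by
  unfold acceptProb
  fun_prop

lemma acceptProb_le {σ x y : ℝ} (hσ : 0 < σ) (hy : y < 0) :
    acceptProb σ x y ≤ 2 * Real.exp (((|x + 1| / σ) ^ 2 - (|y + 1| / σ) ^ 2) / 2) := by
  refine (min_le_right _ _).trans ?_
  rw [div_le_iff₀ (mixDensity_pos hσ x)]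
  calc mixDensity σ y ≤ gaussDensity σ (y + 1) := mixDensity_le hy
    _ = 2 * Real.exp (((|x + 1| / σ) ^ 2 - (|y + 1| / σ) ^ 2) / 2) *
          (1 / 2 * gaussDensity σ (x + 1)) := by
        rw [gaussDensity_eq_exp_mul σ (x + 1) (y + 1)]; ring
    _ ≤ _ := by
        gcongr
        exact le_mixDensity σ x

lemma half_le_acceptProb {σ x y : ℝ} (hσ : 0 < σ) (hx : x < 0) (h : |y + 1| ≤ |x + 1|) :
    1 / 2 ≤ acceptProb σ x y := by
  refine le_min (by norm_num) ?_
  rw [le_div_iff₀ (mixDensity_pos hσ x)]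
  calc 1 / 2 * mixDensity σ x ≤ 1 / 2 * gaussDensity σ (x + 1) := by
        gcongr
        exact mixDensity_le hx
    _ ≤ 1 / 2 * gaussDensity σ (y + 1) := by
        gcongr
        exact gaussDensity_le_gaussDensity (sq_le_sq.mpr h)
    _ ≤ _ := le_mixDensity σ y

lemma lyapV_of_neg {σ x : ℝ} (hx : x < 0) : lyapV σ x = Real.exp (|x + 1| / σ) := by
  have h : |x + 1| ≤ |x - 1| := sq_le_sq.mp (by nlinarith)
  rw [lyapV, min_eq_right h, div_eq_inv_mul]

@[fun_prop]
lemma continuous_lyapV (σ : ℝ) : Continuous (lyapV σ) := by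
  unfold lyapV
  fun_prop

lemma lyapV_pos (σ x : ℝ) : 0 < lyapV σ x := Real.exp_pos _

lemma exp_sub_exp_mul_le_four {A B a : ℝ} (hA : 0 ≤ A) (ha : 0 ≤ a)
    (h : a ≤ 2 * Real.exp ((A ^ 2 - B ^ 2) / 2)) :
    (Real.exp B - Real.exp A) * a ≤ 4 * Real.exp A := by
  rcases le_total B A with hBA | hAB
  · have := mul_nonneg (sub_nonneg.mpr (Real.exp_le_exp.mpr hBA)) ha
    nlinarith [Real.exp_pos A]
  · have hhalf : Real.exp (1 / 2) ≤ 2 := by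
      have h₁ : Real.exp (1 / 2) ^ 2 = Real.exp 1 := by
        rw [← Real.exp_nat_mul]; norm_num
      nlinarith [Real.exp_one_lt_d9, Real.exp_pos (1 / 2)]
    calc (Real.exp B - Real.exp A) * a ≤ Real.exp B * a := by
          gcongr
          linarith [Real.exp_pos A]
      _ ≤ Real.exp B * (2 * Real.exp ((A ^ 2 - B ^ 2) / 2)) := by gcongr
      _ = 2 * Real.exp (B + (A ^ 2 - B ^ 2) / 2) := by rw [Real.exp_add]; ring
      _ ≤ 2 * Real.exp (1 / 2 + A) := by
          refine mul_le_mul_of_nonneg_left (Real.exp_le_exp.mpr ?_) zero_le_two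
          nlinarith [sq_nonneg (B - A - 1), mul_nonneg hA (sub_nonneg.mpr hAB)]
      _ = 2 * (Real.exp (1 / 2) * Real.exp A) := by rw [Real.exp_add]
      _ ≤ 2 * (2 * Real.exp A) := by gcongr
      _ = 4 * Real.exp A := by ring

lemma exp_sub_exp_mul_le_div {A B a R : ℝ} (hR : 1 < R) (hRA : R ≤ A) (ha : 0 ≤ a)
    (h : a ≤ 2 * Real.exp ((A ^ 2 - B ^ 2) / 2)) :
    (Real.exp B - Real.exp A) * a ≤ Real.exp A * (2 / (R - 1)) := by
  have hR' : 0 < R - 1 := by linarith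
  rcases le_total B A with hBA | hAB
  · have := mul_nonneg (sub_nonneg.mpr (Real.exp_le_exp.mpr hBA)) ha
    have : 0 ≤ Real.exp A * (2 / (R - 1)) := by positivity
    linarith
  · set d := B - A
    have hd : 0 ≤ d := sub_nonneg.mpr hAB
    have hexp : Real.exp B - Real.exp A ≤ d * Real.exp B := by
      have h₁ : Real.exp A = Real.exp (-d) * Real.exp B := by
        rw [← Real.exp_add]; congr 1; ring
      nlinarith [Real.add_one_le_exp (-d), Real.exp_pos B]
    have hdecay : d * Real.exp (-((R - 1) * d)) ≤ 1 / (R - 1) := by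
      rw [Real.exp_neg, ← div_eq_mul_inv, div_le_div_iff₀ (Real.exp_pos _) hR']
      nlinarith [Real.add_one_le_exp ((R - 1) * d)]
    calc (Real.exp B - Real.exp A) * a
        ≤ (d * Real.exp B) * (2 * Real.exp ((A ^ 2 - B ^ 2) / 2)) := by gcongr
      _ = 2 * d * Real.exp (B + (A ^ 2 - B ^ 2) / 2) := by rw [Real.exp_add]; ring
      _ ≤ 2 * d * Real.exp (A + -((R - 1) * d)) := by
          refine mul_le_mul_of_nonneg_left (Real.exp_le_exp.mpr ?_) (by positivity)
          nlinarith [sq_nonneg d, mul_nonneg hd (sub_nonneg.mpr hRA)]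
      _ = 2 * Real.exp A * (d * Real.exp (-((R - 1) * d))) := by rw [Real.exp_add]; ring
      _ ≤ 2 * Real.exp A * (1 / (R - 1)) := by gcongr
      _ = Real.exp A * (2 / (R - 1)) := by ring

/-- The density of the accepted moves of the Metropolis kernel started at `x`. -/
noncomputable def moveDensity (σ x y : ℝ) : ℝ := acceptProb σ x y * gaussDensity σ (y - x)

lemma moveDensity_nonneg {σ : ℝ} (hσ : 0 < σ) (x y : ℝ) : 0 ≤ moveDensity σ x y :=
  mul_nonneg (acceptProb_nonneg hσ x y) (gaussDensity_nonneg σ _)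

lemma moveDensity_le (σ x y : ℝ) : moveDensity σ x y ≤ gaussDensity σ (y - x) :=
  mul_le_of_le_one_left (gaussDensity_nonneg σ _) (acceptProb_le_one σ x y)

@[fun_prop]
lemma continuous_moveDensity (σ x : ℝ) : Continuous (moveDensity σ x) := by
  unfold moveDensity
  fun_prop

lemma integrable_gaussDensity_sub (σ x : ℝ) : Integrable fun y => gaussDensity σ (y - x) :=
  (integrable_gaussDensity σ).comp_sub_right x

lemma integral_gaussDensity_sub {σ : ℝ} (hσ : 0 < σ) (x : ℝ) :
    ∫ y, gaussDensity σ (y - x) = 1 := by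
  rw [integral_sub_right_eq_self (gaussDensity σ), integral_gaussDensity hσ]

lemma integrable_moveDensity {σ : ℝ} (hσ : 0 < σ) (x : ℝ) : Integrable (moveDensity σ x) := by
  refine (integrable_gaussDensity_sub σ x).mono' (by fun_prop) (ae_of_all _ fun y => ?_)
  rw [Real.norm_of_nonneg (moveDensity_nonneg hσ x y)]
  exact moveDensity_le σ x y

lemma integral_moveDensity_le_one {σ : ℝ} (hσ : 0 < σ) (x : ℝ) :
    ∫ y, moveDensity σ x y ≤ 1 := by
  rw [← integral_gaussDensity_sub hσ x]
  exact integral_mono (integrable_moveDensity hσ x) (integrable_gaussDensity_sub σ x)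
    (moveDensity_le σ x)

lemma map_add_gaussMeasure (σ x : ℝ) :
    (gaussMeasure σ).map (fun z => x + z) =
      volume.withDensity fun y => ENNReal.ofReal (gaussDensity σ (y - x)) := by
  ext s hs
  have hm : Measurable fun z : ℝ => x + z := by fun_prop
  rw [Measure.map_apply hm hs, gaussMeasure, withDensity_apply _ (hm hs), withDensity_apply _ hs,
    ← (measurePreserving_add_left volume x).setLIntegral_comp_preimage hs (by fun_prop)]
  simp

lemma rwmKernel_eq {σ : ℝ} (hσ : 0 < σ) (x : ℝ) :
    rwmKernel σ x = (volume.withDensity fun y => ENNReal.ofReal (moveDensity σ x y)) +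
      ENNReal.ofReal (1 - ∫ y, moveDensity σ x y) • Measure.dirac x := by
  have hint : ∫ z, min 1 (mixDensity σ (x + z) / mixDensity σ x) * gaussDensity σ z =
      ∫ y, moveDensity σ x y := by
    rw [← integral_add_left_eq_self (moveDensity σ x) x]
    simp [moveDensity, acceptProb]
  rw [rwmKernel, hint, map_add_gaussMeasure, ← withDensity_mul _ (by fun_prop) (by fun_prop)]
  congr 2
  ext y
  rw [Pi.mul_apply, mul_comm]
  exact (ENNReal.ofReal_mul (acceptProb_nonneg hσ x y)).symm

lemma lyapV_sub_mul_moveDensity_le_four {σ x y : ℝ} (hσ : 0 < σ) (hx : x < 0) (hy : y < 0) :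
    (lyapV σ y - lyapV σ x) * moveDensity σ x y ≤
      4 * lyapV σ x * gaussDensity σ (y - x) := by
  rw [moveDensity, ← mul_assoc, lyapV_of_neg hx, lyapV_of_neg hy]
  exact mul_le_mul_of_nonneg_right (exp_sub_exp_mul_le_four (by positivity)
    (acceptProb_nonneg hσ x y) (acceptProb_le hσ hy)) (gaussDensity_nonneg σ _)

lemma integrableOn_lyapV_mul_moveDensity {σ x : ℝ} (hσ : 0 < σ) (hx : x < 0) :
    IntegrableOn (fun y => lyapV σ y * moveDensity σ x y) (Iio 0) := by
  refine ((integrable_gaussDensity_sub σ x).const_mul (5 * lyapV σ x)).integrableOn.mono'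
    (by fun_prop) ((ae_restrict_iff' measurableSet_Iio).mpr (ae_of_all _ fun y hy => ?_))
  rw [Real.norm_of_nonneg (mul_nonneg (lyapV_pos σ y).le (moveDensity_nonneg hσ x y))]
  have h₁ := lyapV_sub_mul_moveDensity_le_four hσ hx hy
  have h₂ := mul_le_mul_of_nonneg_left (moveDensity_le σ x y) (lyapV_pos σ x).le
  linarith

lemma integrableOn_lyapV_sub_mul_moveDensity {σ x : ℝ} (hσ : 0 < σ) (hx : x < 0) :
    IntegrableOn (fun y => (lyapV σ y - lyapV σ x) * moveDensity σ x y) (Iio 0) := by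
  simp_rw [sub_mul]
  exact (integrableOn_lyapV_mul_moveDensity hσ hx).sub
    ((integrable_moveDensity hσ x).const_mul _).integrableOn

lemma integral_lyapV_rwmKernelHat {σ x : ℝ} (hσ : 0 < σ) (hx : x < 0) :
    ∫ y, lyapV σ y ∂(rwmKernelHat σ x) =
      lyapV σ x + ∫ y in Iio 0, (lyapV σ y - lyapV σ x) * moveDensity σ x y := by
  have hq := integrable_moveDensity hσ x
  have hV := integrableOn_lyapV_mul_moveDensity hσ hx
  have hq0 := moveDensity_nonneg hσ x
  have hmass : rwmKernel σ x (Ici 0) = ENNReal.ofReal (∫ y in Ici 0, moveDensity σ x y) := by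
    rw [rwmKernel_eq hσ, Measure.add_apply, withDensity_apply _ measurableSet_Ici,
      ofReal_integral_eq_lintegral_ofReal hq.integrableOn (ae_of_all _ hq0)]
    simp [hx]
  have hrestrict : (rwmKernel σ x).restrict (Iio 0) =
      (volume.restrict (Iio 0)).withDensity (fun y => ENNReal.ofReal (moveDensity σ x y)) +
        ENNReal.ofReal (1 - ∫ y, moveDensity σ x y) • Measure.dirac x := by
    rw [rwmKernel_eq hσ, Measure.restrict_add, Measure.restrict_smul,
      restrict_withDensity measurableSet_Iio, restrict_dirac' measurableSet_Iio,
      if_pos (mem_Iio.mpr hx)]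
  have hdirac (r : ℝ) : Integrable (lyapV σ) (ENNReal.ofReal r • Measure.dirac x) :=
    (integrable_dirac (by simp)).smul_measure ENNReal.ofReal_ne_top
  have hmove : Integrable (lyapV σ) ((volume.restrict (Iio 0)).withDensity
      fun y => ENNReal.ofReal (moveDensity σ x y)) := by
    rw [integrable_withDensity_iff (by fun_prop) (by simp)]
    simp_rw [ENNReal.toReal_ofReal (hq0 _)]
    exact hV
  have hsplit : ∫ y, moveDensity σ x y =
      (∫ y in Iio 0, moveDensity σ x y) + ∫ y in Ici 0, moveDensity σ x y := by
    rw [← compl_Iio, integral_add_compl measurableSet_Iio hq]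
  rw [rwmKernelHat, hmass, hrestrict, integral_add_measure (hmove.add_measure (hdirac _)) (hdirac _),
    integral_add_measure hmove (hdirac _), integral_smul_measure, integral_smul_measure,
    integral_dirac, integral_withDensity_eq_integral_toReal_smul (by fun_prop) (by simp),
    ENNReal.toReal_ofReal (sub_nonneg.mpr (integral_moveDensity_le_one hσ x)),
    ENNReal.toReal_ofReal (integral_nonneg hq0)]
  simp_rw [sub_mul, ENNReal.toReal_ofReal (hq0 _), smul_eq_mul]
  rw [integral_sub hV (hq.const_mul _).integrableOn, integral_const_mul, hsplit]
  simp_rw [mul_comm (moveDensity σ x _)]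
  ring

/-- A lower bound for the probability that a standard Gaussian lies in `[1/2, 1]`. -/
noncomputable def gaussIntervalMass : ℝ := (Real.sqrt (2 * Real.pi))⁻¹ * Real.exp (-(1 / 2)) / 2

lemma gaussIntervalMass_pos : 0 < gaussIntervalMass := by
  unfold gaussIntervalMass
  positivity

lemma gaussIntervalMass_le_integral {σ : ℝ} (hσ : 0 < σ) {x a : ℝ}
    (h : ∀ y ∈ Icc a (a + σ / 2), |y - x| ≤ σ) :
    gaussIntervalMass ≤ ∫ y in Icc a (a + σ / 2), gaussDensity σ (y - x) := by
  have hle : ∀ y ∈ Icc a (a + σ / 2), gaussDensity σ σ ≤ gaussDensity σ (y - x) := fun y hy =>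
    gaussDensity_le_gaussDensity (sq_le_sq.mpr ((h y hy).trans (le_abs_self σ)))
  have hconst : ∫ _ in Icc a (a + σ / 2), gaussDensity σ σ = gaussIntervalMass := by
    have hs : Real.sqrt (2 * Real.pi * σ ^ 2) = Real.sqrt (2 * Real.pi) * σ := by
      rw [Real.sqrt_mul (by positivity), Real.sqrt_sq hσ.le]
    have he : -(σ ^ 2) / (2 * σ ^ 2) = -(1 / 2) := by field_simp
    rw [setIntegral_const, measureReal_def, Real.volume_Icc, add_sub_cancel_left,
      ENNReal.toReal_ofReal (by positivity), smul_eq_mul, gaussDensity, hs, he, gaussIntervalMass]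
    field_simp
  rw [← hconst]
  exact setIntegral_mono_on (integrableOn_const (by simp))
    (integrable_gaussDensity_sub σ x).integrableOn measurableSet_Icc hle

/-- Moves towards the mode `-1` by between half a step size and a full one are accepted with
probability at least `1/2`, and decrease the Lyapunov function by a fixed factor. -/
lemma lyapV_sub_mul_acceptProb_le {σ x y : ℝ} (hσ : 0 < σ) (hx : x < 0) (hy : y < 0)
    (h : |y + 1| ≤ |x + 1| - σ / 2) :
    (lyapV σ y - lyapV σ x) * acceptProb σ x y ≤
      -(lyapV σ x * ((1 - Real.exp (-(1 / 2))) / 2)) := by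
  have hV : lyapV σ y ≤ lyapV σ x * Real.exp (-(1 / 2)) := by
    rw [lyapV_of_neg hx, lyapV_of_neg hy, ← Real.exp_add, Real.exp_le_exp, div_le_iff₀ hσ,
      add_mul, div_mul_cancel₀ _ hσ.ne']
    linarith
  have ha : 1 / 2 ≤ acceptProb σ x y := half_le_acceptProb hσ hx (by linarith)
  have he : Real.exp (-(1 / 2)) < 1 := Real.exp_lt_one_iff.mpr (by norm_num)
  have hp : 0 < lyapV σ x * (1 - Real.exp (-(1 / 2))) :=
    mul_pos (lyapV_pos σ x) (by linarith)
  nlinarith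

lemma setIntegral_lyapV_sub_mul_moveDensity_le_four {σ x : ℝ} (hσ : 0 < σ) (hx : x < 0) :
    ∫ y in Iio 0, (lyapV σ y - lyapV σ x) * moveDensity σ x y ≤ 4 * lyapV σ x := by
  have hg := (integrable_gaussDensity_sub σ x).const_mul (4 * lyapV σ x)
  calc ∫ y in Iio 0, (lyapV σ y - lyapV σ x) * moveDensity σ x y
      ≤ ∫ y in Iio 0, 4 * lyapV σ x * gaussDensity σ (y - x) :=
        setIntegral_mono_on (integrableOn_lyapV_sub_mul_moveDensity hσ hx) hg.integrableOn
          measurableSet_Iio fun y hy => lyapV_sub_mul_moveDensity_le_four hσ hx hy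
    _ ≤ ∫ y, 4 * lyapV σ x * gaussDensity σ (y - x) :=
        setIntegral_le_integral hg (ae_of_all _ fun y =>
          mul_nonneg (mul_nonneg zero_le_four (lyapV_pos σ x).le) (gaussDensity_nonneg σ _))
    _ = 4 * lyapV σ x := by rw [integral_const_mul, integral_gaussDensity_sub hσ, mul_one]

lemma exists_Icc_towards_mode {σ x : ℝ} (hσ : 0 < σ) (hx : x < 0) (h : σ ≤ |x + 1|) :
    ∃ a, ∀ y ∈ Icc a (a + σ / 2), y < 0 ∧ |y - x| ≤ σ ∧ |y + 1| ≤ |x + 1| - σ / 2 := by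
  rcases le_total 0 (x + 1) with h0 | h0
  · rw [abs_of_nonneg h0] at h ⊢
    refine ⟨x - σ, fun y hy => ⟨by linarith [hy.2], abs_le.mpr ⟨?_, ?_⟩, abs_le.mpr ⟨?_, ?_⟩⟩⟩ <;>
      linarith [hy.1, hy.2]
  · rw [abs_of_nonpos h0] at h ⊢
    refine ⟨x + σ / 2,
      fun y hy => ⟨by linarith [hy.2], abs_le.mpr ⟨?_, ?_⟩, abs_le.mpr ⟨?_, ?_⟩⟩⟩ <;>
      linarith [hy.1, hy.2]

lemma setIntegral_lyapV_sub_mul_moveDensity_le {σ x R : ℝ} (hσ : 0 < σ) (hx : x < 0)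
    (hR : 1 < R) (hRx : R ≤ |x + 1| / σ) :
    ∫ y in Iio 0, (lyapV σ y - lyapV σ x) * moveDensity σ x y ≤
      lyapV σ x * (2 / (R - 1)) -
        lyapV σ x * ((1 - Real.exp (-(1 / 2))) / 2) * gaussIntervalMass := by
  set ε := lyapV σ x * (2 / (R - 1))
  set κ := lyapV σ x * ((1 - Real.exp (-(1 / 2))) / 2)
  have hε : 0 ≤ ε := mul_nonneg (lyapV_pos σ x).le (div_nonneg zero_le_two (by linarith))
  have hκ : 0 ≤ κ := mul_nonneg (lyapV_pos σ x).le
    (by linarith [Real.exp_lt_one_iff.mpr (show -(1 / 2 : ℝ) < 0 by norm_num)])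
  obtain ⟨a, ha⟩ := exists_Icc_towards_mode hσ hx (by
    have := (le_div_iff₀ hσ).mp hRx
    nlinarith)
  set I := Icc a (a + σ / 2)
  have hI : I ⊆ Iio 0 := fun y hy => (ha y hy).1
  have hF := integrableOn_lyapV_sub_mul_moveDensity hσ hx
  have hφ := integrable_gaussDensity_sub σ x
  have hon : ∫ y in I, (lyapV σ y - lyapV σ x) * moveDensity σ x y ≤ -(κ * gaussIntervalMass) :=
    calc ∫ y in I, (lyapV σ y - lyapV σ x) * moveDensity σ x y
        ≤ ∫ y in I, -κ * gaussDensity σ (y - x) := by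
          refine setIntegral_mono_on (hF.mono_set hI) (hφ.const_mul _).integrableOn
            measurableSet_Icc fun y hy => ?_
          rw [moveDensity, ← mul_assoc]
          exact mul_le_mul_of_nonneg_right
            (lyapV_sub_mul_acceptProb_le hσ hx (ha y hy).1 (ha y hy).2.2) (gaussDensity_nonneg σ _)
      _ = -(κ * ∫ y in I, gaussDensity σ (y - x)) := by rw [integral_const_mul, neg_mul]
      _ ≤ -(κ * gaussIntervalMass) := neg_le_neg (mul_le_mul_of_nonneg_left
          (gaussIntervalMass_le_integral hσ fun y hy => (ha y hy).2.1) hκ)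
  have hoff : ∫ y in Iio 0 \ I, (lyapV σ y - lyapV σ x) * moveDensity σ x y ≤ ε :=
    calc ∫ y in Iio 0 \ I, (lyapV σ y - lyapV σ x) * moveDensity σ x y
        ≤ ∫ y in Iio 0 \ I, ε * gaussDensity σ (y - x) := by
          refine setIntegral_mono_on (hF.mono_set sdiff_subset) (hφ.const_mul _).integrableOn
            (measurableSet_Iio.diff measurableSet_Icc) fun y hy => ?_
          rw [moveDensity, ← mul_assoc]
          refine mul_le_mul_of_nonneg_right ?_ (gaussDensity_nonneg σ _)
          simp only [ε]
          rw [lyapV_of_neg hx, lyapV_of_neg hy.1]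
          exact exp_sub_exp_mul_le_div hR hRx (acceptProb_nonneg hσ x y) (acceptProb_le hσ hy.1)
      _ ≤ ∫ y, ε * gaussDensity σ (y - x) := setIntegral_le_integral (hφ.const_mul _)
          (ae_of_all _ fun y => mul_nonneg hε (gaussDensity_nonneg σ _))
      _ = ε := by rw [integral_const_mul, integral_gaussDensity_sub hσ, mul_one]
  rw [← integral_inter_add_sdiff measurableSet_Icc hF, inter_eq_self_of_subset_right hI]
  linarith

/-- Drift condition for the restricted Metropolis–Hastings kernel `K̂_σ` on `(-∞, -Mσ)`:
`(K̂_σ V_σ)(x) ≤ (1-α) V_σ(x) + C`. -/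
theorem stmt9 :
    ∃ α M C σ₀ : ℝ, 0 < α ∧ α ≤ 1 ∧ 0 ≤ M ∧ 0 ≤ C ∧ 0 < σ₀ ∧
      ∀ σ : ℝ, 0 < σ → σ < σ₀ → ∀ x : ℝ, x < -(M * σ) →
        (∫ y, lyapV σ y ∂(rwmKernelHat σ x)) ≤ (1 - α) * lyapV σ x + C := by
  have he : Real.exp (-(1 / 2)) < 1 := Real.exp_lt_one_iff.mpr (by norm_num)
  set c := (1 - Real.exp (-(1 / 2))) / 2 * gaussIntervalMass with hc
  have hc0 : 0 < c := mul_pos (by linarith) gaussIntervalMass_pos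
  refine ⟨min 1 (c / 2), 0, 5 * Real.exp (1 + 4 / c), 1, by positivity, min_le_left _ _, le_rfl,
    by positivity, one_pos, fun σ hσ _ x hx => ?_⟩
  have hx : x < 0 := by simpa using hx
  have hV := lyapV_pos σ x
  rw [integral_lyapV_rwmKernelHat hσ hx]
  rcases le_total (1 + 4 / c) (|x + 1| / σ) with hR | hR
  · have h := setIntegral_lyapV_sub_mul_moveDensity_le hσ hx
      (by linarith [show 0 < 4 / c by positivity]) hR
    have hRc : 2 / (1 + 4 / c - 1) = c / 2 := by
      field_simp
      ring
    rw [hRc, mul_assoc, ← hc] at h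
    nlinarith [min_le_right 1 (c / 2), Real.exp_pos (1 + 4 / c)]
  · have h := setIntegral_lyapV_sub_mul_moveDensity_le_four hσ hx
    have hVR : lyapV σ x ≤ Real.exp (1 + 4 / c) := by
      rw [lyapV_of_neg hx]
      exact Real.exp_le_exp.mpr hR
    nlinarith [min_le_left 1 (c / 2)]
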